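/- arXiv:2011.02733 — 2 statements merged into one kernel-verified Lean document; each statement's English description precedes it below -/
import Mathlib

section
/- Fix θ > 0 and H ∈ (1/2, 1). Then lim_{t → +∞} e^{t/θ} t^{2-2H} V'_{2,H}(t) = 2H(2H-1)θ, where V'_{2,H}(t) = 2H(2H-1) e^{-2t/θ} ∫_0^t e^{z/θ} z^{2H-2} dz is the derivative of V_{2,H}. -/
open Real Filter Set

/-- The derivative of the variance of the fractional Ornstein–Uhlenbeck process:
`V'_{2,H}(t) = 2H(2H-1) e^{-2t/θ} ∫_0^t e^{z/θ} z^{2H-2} dz`. -/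
noncomputable def V2' (θ H t : ℝ) : ℝ :=
  2 * H * (2 * H - 1) * Real.exp (-(2 * t) / θ) *
    ∫ z in (0:ℝ)..t, Real.exp (z / θ) * z ^ (2 * H - 2)

lemma aux_G (θ : ℝ) (hθ : 0 < θ) (r t : ℝ) (ht : 0 < t) :
    HasDerivAt (fun t : ℝ => θ * (Real.exp (t / θ) * t ^ r))
      (Real.exp (t / θ) * t ^ r + θ * r * Real.exp (t / θ) * t ^ (r - 1)) t := by
  have h1 : HasDerivAt (fun t : ℝ => Real.exp (t / θ)) (Real.exp (t / θ) * (1 / θ)) t :=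
    ((hasDerivAt_id t).div_const θ).exp
  have h2 := Real.hasDerivAt_rpow_const (x := t) (p := r) (Or.inl ht.ne')
  refine ((h1.mul h2).const_mul θ).congr_deriv ?_
  field_simp

lemma aux_int (θ : ℝ) (r : ℝ) (hr : -1 < r) (a b : ℝ) :
    IntervalIntegrable (fun z : ℝ => Real.exp (z / θ) * z ^ r) MeasureTheory.volume a b :=
  (intervalIntegral.intervalIntegrable_rpow' hr).continuousOn_mul (by fun_prop)

lemma aux_F (θ : ℝ) (r : ℝ) (hr : -1 < r) (t : ℝ) (ht : 0 < t) :
    HasDerivAt (fun t : ℝ => ∫ z in (0:ℝ)..t, Real.exp (z / θ) * z ^ r)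
      (Real.exp (t / θ) * t ^ r) t := by
  apply intervalIntegral.integral_hasDerivAt_right (aux_int θ r hr 0 t)
  · have : Measurable (fun z : ℝ => Real.exp (z / θ) * z ^ r) := by fun_prop
    exact this.stronglyMeasurable.stronglyMeasurableAtFilter
  · have := Real.continuousAt_rpow_const t r (Or.inl ht.ne')
    fun_prop

lemma aux_mono (T : ℝ) (f f' : ℝ → ℝ) (h : ∀ t, T ≤ t → HasDerivAt f (f' t) t)
    (h' : ∀ t, T ≤ t → 0 ≤ f' t) : ∀ t, T ≤ t → f T ≤ f t := by
  have : MonotoneOn f (Ici T) := by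
    apply monotoneOn_of_deriv_nonneg (convex_Ici T)
    · exact fun t ht => (h t ht).continuousAt.continuousWithinAt
    · intro t ht
      rw [interior_Ici] at ht
      exact (h t (le_of_lt ht)).differentiableAt.differentiableWithinAt
    · intro t ht
      rw [interior_Ici] at ht
      rw [(h t (le_of_lt ht)).deriv]
      exact h' t (le_of_lt ht)
  exact fun t ht => this self_mem_Ici ht ht

lemma aux_main (θ : ℝ) (hθ : 0 < θ) (r : ℝ) (hr : -1 < r) (hr0 : r < 0) :
    Tendsto (fun t : ℝ => (Real.exp (-(t / θ)) * t ^ (-r)) *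
      ∫ z in (0:ℝ)..t, Real.exp (z / θ) * z ^ r) atTop (nhds θ) := by
  set F : ℝ → ℝ := fun t => ∫ z in (0:ℝ)..t, Real.exp (z / θ) * z ^ r with hF
  set G : ℝ → ℝ := fun t => θ * (Real.exp (t / θ) * t ^ r) with hG
  set K : ℝ → ℝ := fun t => θ * (Real.exp (t / θ) * t ^ (r - 1)) with hK
  set p : ℝ → ℝ := fun t => Real.exp (-(t / θ)) * t ^ (-r) with hp
  have hT : 0 < 4 * θ := by positivity
  have lo := aux_mono (4 * θ) (fun t => F t - G t) _
    (fun t ht => (aux_F θ r hr t (hT.trans_le ht)).sub (aux_G θ hθ r t (hT.trans_le ht)))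
    (by
      intro t ht
      have ht0 := hT.trans_le ht
      have : 0 ≤ (-r) * (θ * Real.exp (t / θ) * t ^ (r - 1)) :=
        mul_nonneg (by linarith) (by positivity)
      linarith)
  have hi := aux_mono (4 * θ) (fun t => G t + (-2 * θ * r) * K t - F t) _
    (fun t ht => ((aux_G θ hθ r t (hT.trans_le ht)).add
      ((aux_G θ hθ (r - 1) t (hT.trans_le ht)).const_mul (-2 * θ * r))).sub
      (aux_F θ r hr t (hT.trans_le ht)))
    (by
      intro t ht
      have ht0 := hT.trans_le ht
      have e : t ^ (r - 1) = t ^ (r - 1 - 1) * t := by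
        rw [← Real.rpow_add_one ht0.ne']; ring_nf
      have h1 : 0 ≤ t + 2 * θ * (r - 1) := by nlinarith
      have : 0 ≤ (-r) * (θ * Real.exp (t / θ) * t ^ (r - 1 - 1) * (t + 2 * θ * (r - 1))) :=
        mul_nonneg (by linarith) (by positivity)
      rw [e]
      linarith)
  have hp0 : Tendsto p atTop (nhds 0) := by
    have := tendsto_rpow_mul_exp_neg_mul_atTop_nhds_zero (-r) (1 / θ) (by positivity)
    refine this.congr fun t => ?_
    simp only [hp]
    rw [mul_comm]; congr 2; ring
  have hpG : ∀ t, 0 < t → p t * G t = θ := by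
    intro t ht
    simp only [hp, hG]
    rw [Real.exp_neg, Real.rpow_neg ht.le]
    have := Real.rpow_pos_of_pos ht r
    field_simp
  have hpK : ∀ t, 0 < t → p t * K t = θ * t⁻¹ := by
    intro t ht
    simp only [hp, hK]
    rw [Real.exp_neg, Real.rpow_neg ht.le, Real.rpow_sub_one ht.ne']
    have := Real.rpow_pos_of_pos ht r
    field_simp
  have hpp : ∀ t, 0 < t → 0 ≤ p t := fun t ht => by simp only [hp]; positivity
  have l1 : Tendsto (fun t => θ + p t * (F (4 * θ) - G (4 * θ))) atTop (nhds θ) := by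
    simpa using (hp0.mul_const (F (4 * θ) - G (4 * θ))).const_add θ
  have l2 : Tendsto (fun t => θ + (-2 * θ * r) * (θ * t⁻¹) -
      p t * (G (4 * θ) + (-2 * θ * r) * K (4 * θ) - F (4 * θ))) atTop (nhds θ) := by
    have := (((tendsto_inv_atTop_zero (𝕜 := ℝ)).const_mul θ).const_mul (-2 * θ * r)).const_add θ
    simpa using this.sub (hp0.mul_const (G (4 * θ) + (-2 * θ * r) * K (4 * θ) - F (4 * θ)))
  refine tendsto_of_tendsto_of_tendsto_of_le_of_le' l1 l2 ?_ ?_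
  · filter_upwards [eventually_ge_atTop (4 * θ)] with t ht
    have ht0 := hT.trans_le ht
    have := mul_le_mul_of_nonneg_left (lo t ht) (hpp t ht0)
    have e := hpG t ht0
    simp only [mul_sub] at this ⊢
    linarith
  · filter_upwards [eventually_ge_atTop (4 * θ)] with t ht
    have ht0 := hT.trans_le ht
    have := mul_le_mul_of_nonneg_left (hi t ht) (hpp t ht0)
    have e := hpG t ht0
    have e2 := hpK t ht0
    rw [← e2]
    have e3 : p t * (G t + (-2 * θ * r) * K t - F t) =
      p t * G t + (-2 * θ * r) * (p t * K t) - p t * F t := by ring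
    linarith

/-- `lim_{t → +∞} e^{t/θ} t^{2-2H} V'_{2,H}(t) = 2H(2H-1)θ`. -/
theorem V2'_asymptotic_atTop (θ : ℝ) (hθ : 0 < θ) (H : ℝ)
    (hH : H ∈ Set.Ioo (1/2 : ℝ) 1) :
    Tendsto (fun t : ℝ => Real.exp (t / θ) * t ^ (2 - 2 * H) * V2' θ H t) atTop
      (nhds (2 * H * (2 * H - 1) * θ)) := by
  obtain ⟨h1, h2⟩ := hH
  refine ((aux_main θ hθ (2 * H - 2) (by linarith) (by linarith)).const_mul
    (2 * H * (2 * H - 1))).congr fun t => ?_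
  have e : Real.exp (-(t / θ)) = Real.exp (t / θ) * Real.exp (-(2 * t) / θ) := by
    rw [← Real.exp_add]; congr 1; ring
  rw [V2', e, neg_sub]
  ring
end

section
/- Fix θ > 0 and H ∈ (1/2, 1). Then inf_{t ∈ (0,1]} V_{2,H}(t)/t^{2H} > 0; equivalently, there exists a constant C(H) > 0 such that V_{2,H}(t) ≥ C(H) t^{2H} for all t ∈ (0,1]. -/
open Real Filter Set

/-- The variance of the fractional Ornstein–Uhlenbeck process with Hurst index `H`
and drift parameter `1/θ`. -/
noncomputable def V2 (θ H t : ℝ) : ℝ :=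
  Real.exp (-(2 * t) / θ) *
    ∫ u in (0:ℝ)..t, ∫ v in (0:ℝ)..t, Real.exp ((u + v) / θ) * |u - v| ^ (2 * H - 2)

lemma aux_abs_rpow_int {r : ℝ} (hr : -1 < r) (a b : ℝ) :
    IntervalIntegrable (fun x : ℝ => |x| ^ r) MeasureTheory.volume a b := by
  apply intervalIntegrable_of_even
  · intro x; simp
  · intro x hx
    refine (intervalIntegral.intervalIntegrable_rpow' (a := 0) (b := x) hr).congr ?_
    intro y hy
    rw [uIoc_of_le hx.le] at hy
    simp [abs_of_pos hy.1]
  · finiteness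
  · finiteness

lemma aux_inner_int {r : ℝ} (hr : -1 < r) (u a b : ℝ) :
    IntervalIntegrable (fun v : ℝ => |u - v| ^ r) MeasureTheory.volume a b := by
  have := (aux_abs_rpow_int hr (u - a) (u - b)).comp_sub_left u
  simpa using this

/-- There is a constant `C(H) > 0` with `V_{2,H}(t) ≥ C(H) t^{2H}` for all `t ∈ (0,1]`. -/
theorem V2_lower_bound (θ : ℝ) (hθ : 0 < θ) (H : ℝ) (hH : H ∈ Set.Ioo (1/2 : ℝ) 1) :
    ∃ C > (0:ℝ), ∀ t ∈ Set.Ioc (0:ℝ) 1, C * t ^ (2 * H) ≤ V2 θ H t := by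
  obtain ⟨h1, h2⟩ := hH
  have hr : -1 < 2 * H - 2 := by linarith
  refine ⟨Real.exp (-2 / θ), Real.exp_pos _, ?_⟩
  rintro t ⟨ht0, ht1⟩
  unfold V2
  have hexp : Real.exp (-2 / θ) ≤ Real.exp (-(2 * t) / θ) := by
    apply Real.exp_le_exp.mpr
    gcongr
    linarith
  refine mul_le_mul hexp ?_ (by positivity) (Real.exp_pos _).le
  have hin : ∀ u, IntervalIntegrable
      (fun v : ℝ => Real.exp ((u + v) / θ) * |u - v| ^ (2 * H - 2)) MeasureTheory.volume 0 t := by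
    intro u
    exact (aux_inner_int hr u 0 t).continuousOn_mul (by fun_prop)
  have hlow : ∀ u ∈ Icc (0:ℝ) t, t * t ^ (2 * H - 2) ≤
      ∫ v in (0:ℝ)..t, Real.exp ((u + v) / θ) * |u - v| ^ (2 * H - 2) := by
    intro u hu
    have : t * t ^ (2 * H - 2) = ∫ v in (0:ℝ)..t, t ^ (2 * H - 2) := by simp
    rw [this]
    refine intervalIntegral.integral_mono_ae_restrict ht0.le (by simp) (hin u) ?_
    have hne : ∀ᵐ v ∂(MeasureTheory.volume.restrict (Icc (0:ℝ) t)), v ≠ u :=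
      MeasureTheory.ae_restrict_of_ae (MeasureTheory.Measure.ae_ne _ u)
    filter_upwards [hne, MeasureTheory.ae_restrict_mem measurableSet_Icc] with v hv hv2
    have hpos : 0 < |u - v| := abs_pos.mpr (sub_ne_zero.mpr hv.symm)
    have hle : |u - v| ≤ t := by
      rw [abs_le]; constructor <;> linarith [hu.1, hu.2, hv2.1, hv2.2]
    have hA : t ^ (2 * H - 2) ≤ |u - v| ^ (2 * H - 2) :=
      Real.rpow_le_rpow_of_nonpos hpos hle (by linarith)
    have hB : 1 ≤ Real.exp ((u + v) / θ) :=
      Real.one_le_exp (div_nonneg (by linarith [hu.1, hv2.1]) hθ.le)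
    calc t ^ (2 * H - 2) ≤ |u - v| ^ (2 * H - 2) := hA
      _ ≤ _ := le_mul_of_one_le_left (by positivity) hB
  have hup : ∀ u ∈ Icc (0:ℝ) t,
      ∫ v in (0:ℝ)..t, Real.exp ((u + v) / θ) * |u - v| ^ (2 * H - 2) ≤
      Real.exp (2 / θ) * ∫ x in (-1:ℝ)..1, |x| ^ (2 * H - 2) := by
    intro u hu
    calc ∫ v in (0:ℝ)..t, Real.exp ((u + v) / θ) * |u - v| ^ (2 * H - 2)
        ≤ ∫ v in (0:ℝ)..t, Real.exp (2 / θ) * |u - v| ^ (2 * H - 2) := by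
          refine intervalIntegral.integral_mono_on ht0.le (hin u)
            ((aux_inner_int hr u 0 t).const_mul _) ?_
          intro v hv
          have : Real.exp ((u + v) / θ) ≤ Real.exp (2 / θ) := by
            apply Real.exp_le_exp.mpr
            gcongr
            linarith [hu.2, hv.2]
          gcongr
      _ = Real.exp (2 / θ) * ∫ x in (u - t)..(u - 0), |x| ^ (2 * H - 2) := by
          rw [intervalIntegral.integral_const_mul,
            intervalIntegral.integral_comp_sub_left (fun x => |x| ^ (2 * H - 2)) u]
      _ ≤ _ := by
          gcongr
          refine intervalIntegral.integral_mono_interval (by linarith [hu.1]) (by linarith)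
            (by linarith [hu.2]) (Eventually.of_forall fun x => ?_) (aux_abs_rpow_int hr _ _)
          simp only [Pi.zero_apply]
          positivity
  have hout : IntervalIntegrable
      (fun u => ∫ v in (0:ℝ)..t, Real.exp ((u + v) / θ) * |u - v| ^ (2 * H - 2))
      MeasureTheory.volume 0 t := by
    refine (intervalIntegrable_const (c := Real.exp (2 / θ) * ∫ x in (-1:ℝ)..1, |x| ^ (2 * H - 2))).mono_fun' ?_ ?_
    · simp only [intervalIntegral.integral_of_le ht0.le]
      apply MeasureTheory.StronglyMeasurable.aestronglyMeasurable
      apply MeasureTheory.StronglyMeasurable.integral_prod_right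
      apply Measurable.stronglyMeasurable
      unfold Function.uncurry
      fun_prop
    · rw [uIoc_of_le ht0.le]
      filter_upwards [MeasureTheory.ae_restrict_mem measurableSet_Ioc] with u hu
      have hu' := Ioc_subset_Icc_self hu
      rw [Real.norm_of_nonneg (le_trans (by positivity) (hlow u hu'))]
      exact hup u hu'
  calc t ^ (2 * H) = ∫ u in (0:ℝ)..t, t * t ^ (2 * H - 2) := by
        rw [intervalIntegral.integral_const, smul_eq_mul, sub_zero, ← mul_assoc]
        have h3 : t ^ (2 * H) = t ^ (2:ℝ) * t ^ (2 * H - 2) := by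
          rw [← Real.rpow_add ht0]
          congr 1
          ring
        rw [h3, Real.rpow_two, sq]
    _ ≤ _ := intervalIntegral.integral_mono_on ht0.le (by simp) hout hlow
end
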